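/- If f is α-strongly convex for some α > 0 and twice continuously differentiable on (0,∞), and the SW-Max maximizers have full support, then the corresponding SW-Max training rule ψ is continuous, with the explicit bound: for every full-support initial model π₀ and any two profiles (r⃗, w⃗) and (r⃗', w⃗'), the maximizers π = ψ(r⃗, w⃗, π₀) and π' = ψ(r⃗', w⃗', π₀) satisfy, for every x ∈ X, |π(x) − π'(x)| ≤ (2·π₀(x)/α)·max_{y∈X} |Σ_{i=1}^n w_i r_i(y) − Σ_{i=1}^n w'_i r'_i(y)|. In particular, for every ε > 0, taking max_y |Σ_i w_i r_i(y) − Σ_i w'_i r'_i(y)| < αε/2 gives max_x |π(x) − π'(x)| ≤ ε. -/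

import Mathlib

open Finset

noncomputable section

variable {X : Type*}

/-- A model is a probability distribution on the finite outcome set `X`. -/
def IsModel [Fintype X] (π : X → ℝ) : Prop :=
  (∀ x, 0 ≤ π x) ∧ ∑ x, π x = 1

/-- A function on `X` has full support if it is everywhere positive. -/
def FullSupport (π : X → ℝ) : Prop :=
  ∀ x, 0 < π x

/-- A reward model normalized by summation. -/
def IsRewardSum [Fintype X] (r : X → ℝ) : Prop :=
  (∀ x, 0 ≤ r x) ∧ ∑ x, r x = 1

/-- A reward model normalized by maximum. -/
def IsRewardMax (r : X → ℝ) : Prop :=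
  (∀ x, 0 ≤ r x) ∧ (∀ x, r x ≤ 1) ∧ ∃ x, r x = 1

/-- The valuation of a model `π` under a reward model `r`. -/
def valuation [Fintype X] (π r : X → ℝ) : ℝ :=
  ∑ x, π x * r x

/-- The `f`-divergence between `π` and `π₀`. -/
def fDiv [Fintype X] (f : ℝ → ℝ) (π π₀ : X → ℝ) : ℝ :=
  ∑ x, π₀ x * f (π x / π₀ x)

/-- The affine social welfare. -/
def ASW [Fintype X] (f : ℝ → ℝ) {n : ℕ} (r : Fin n → X → ℝ) (w : Fin n → ℕ)
    (π π₀ : X → ℝ) : ℝ :=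
  (∑ i, (w i : ℝ) * valuation π (r i)) - fDiv f π π₀

/-- A SW-Max training rule: on every profile of reward models in the domain `Rdom`
and every full-support initial model, it outputs a model maximizing the affine social
welfare.  Weight vectors range over all of `ℕ` so that the rule is also defined on
profiles with a group removed (encoded by a zero weight). -/
def SWMaxRule [Fintype X] (f : ℝ → ℝ) (Rdom : (X → ℝ) → Prop) {n : ℕ}
    (ψ : (Fin n → X → ℝ) → (Fin n → ℕ) → (X → ℝ) → (X → ℝ)) : Prop :=
  ∀ (r : Fin n → X → ℝ) (w : Fin n → ℕ) (π₀ : X → ℝ),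
    (∀ j, Rdom (r j)) → IsModel π₀ → FullSupport π₀ →
      IsModel (ψ r w π₀) ∧
      ∀ π : X → ℝ, IsModel π → ASW f r w π π₀ ≤ ASW f r w (ψ r w π₀) π₀

/-- The affine social welfare as a single sum over outcomes. -/
lemma ASW_eq_sum [Fintype X] (f : ℝ → ℝ) {n : ℕ} (r : Fin n → X → ℝ) (w : Fin n → ℕ)
    (π π₀ : X → ℝ) :
    ASW f r w π π₀ =
      ∑ x, (π x * (∑ i, (w i : ℝ) * r i x) - π₀ x * f (π x / π₀ x)) := by
  unfold ASW valuation fDiv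
  rw [Finset.sum_sub_distrib]
  congr 1
  simp_rw [Finset.mul_sum]
  rw [Finset.sum_comm]
  refine Finset.sum_congr rfl fun x _ => Finset.sum_congr rfl fun i _ => ?_
  ring

/-- First-order condition at a full-support maximizer, along directions of total mass zero. -/
lemma ASW_first_order [Fintype X] {f f' : ℝ → ℝ}
    (hf : ∀ y ∈ Set.Ioi (0 : ℝ), HasDerivAt f (f' y) y)
    {n : ℕ} {r : Fin n → X → ℝ} {w : Fin n → ℕ} {p π₀ : X → ℝ}
    (hπ₀ : FullSupport π₀) (hp : IsModel p) (hpos : FullSupport p)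
    (hmax : ∀ π : X → ℝ, IsModel π → ASW f r w π π₀ ≤ ASW f r w p π₀)
    (d : X → ℝ) (hd : ∑ x, d x = 0) :
    ∑ x, d x * ((∑ i, (w i : ℝ) * r i x) - f' (p x / π₀ x)) = 0 := by
  have hlocal : IsLocalMax (fun t : ℝ => ASW f r w (fun x => p x + t * d x) π₀) 0 := by
    have hev : ∀ᶠ t : ℝ in nhds 0, ∀ x, 0 < p x + t * d x := by
      refine Filter.eventually_all.2 fun x => ?_
      have hc : Continuous fun t : ℝ => p x + t * d x := by fun_prop
      exact hc.continuousAt.eventually (lt_mem_nhds (by simpa using hpos x))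
    filter_upwards [hev] with t ht
    have h := hmax (fun x => p x + t * d x) ⟨fun x => (ht x).le, by
      rw [Finset.sum_add_distrib, ← Finset.mul_sum, hd, hp.2]; simp⟩
    simpa using h
  refine hlocal.hasDerivAt_eq_zero ?_
  simp_rw [ASW_eq_sum]
  refine HasDerivAt.fun_sum fun x _ => ?_
  have hlin : HasDerivAt (fun t : ℝ => p x + t * d x) (d x) 0 := by
    simpa using ((hasDerivAt_id (0 : ℝ)).mul_const (d x)).const_add (p x)
  have hfx : HasDerivAt f (f' (p x / π₀ x)) ((p x + 0 * d x) / π₀ x) := by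
    simpa using hf _ (div_pos (hpos x) (hπ₀ x))
  have hcomp := hfx.comp (0 : ℝ) (hlin.div_const (π₀ x))
  refine ((hlin.mul_const (∑ i, (w i : ℝ) * r i x)).sub
    (hcomp.const_mul (π₀ x))).congr_deriv ?_
  rw [mul_left_comm (π₀ x), mul_div_cancel₀ _ (hπ₀ x).ne']
  ring

/-- At a full-support maximizer, marginal welfare is the same at all outcomes. -/
lemma ASW_marginal_eq [Fintype X] {f f' : ℝ → ℝ}
    (hf : ∀ y ∈ Set.Ioi (0 : ℝ), HasDerivAt f (f' y) y)
    {n : ℕ} {r : Fin n → X → ℝ} {w : Fin n → ℕ} {p π₀ : X → ℝ}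
    (hπ₀ : FullSupport π₀) (hp : IsModel p) (hpos : FullSupport p)
    (hmax : ∀ π : X → ℝ, IsModel π → ASW f r w π π₀ ≤ ASW f r w p π₀) (x y : X) :
    (∑ i, (w i : ℝ) * r i x) - f' (p x / π₀ x) =
      (∑ i, (w i : ℝ) * r i y) - f' (p y / π₀ y) := by
  classical
  have h := ASW_first_order hf hπ₀ hp hpos hmax
    (fun z => (if z = x then 1 else 0) - (if z = y then 1 else 0)) (by simp)
  simp only [sub_mul, ite_mul, one_mul, zero_mul, Finset.sum_sub_distrib,
    Finset.sum_ite_eq', Finset.mem_univ, if_true] at h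
  linarith

/-- A function with derivative at least `α` on `(0, ∞)` grows at rate at least `α` there. -/
lemma mul_sub_le_sub_of_hasDerivAt_ge {g g' : ℝ → ℝ} {α : ℝ}
    (hg : ∀ y ∈ Set.Ioi (0 : ℝ), HasDerivAt g (g' y) y)
    (hg' : ∀ y ∈ Set.Ioi (0 : ℝ), α ≤ g' y) {a b : ℝ} (ha : 0 < a) (hab : a ≤ b) :
    α * (b - a) ≤ g b - g a := by
  refine (convex_Ioi (0 : ℝ)).mul_sub_le_image_sub_of_le_deriv
    (fun y hy => (hg y hy).continuousAt.continuousWithinAt)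
    (fun y hy => ?_) (fun y hy => ?_) a ha b (ha.trans_le hab) hab
  · rw [interior_Ioi] at hy
    exact (hg y hy).differentiableAt.differentiableWithinAt
  · rw [interior_Ioi] at hy
    rw [(hg y hy).deriv]
    exact hg' y hy

/-- One-sided stability of full-support maximizers under perturbation of the rewards. -/
lemma ASW_maximizer_sub_le [Fintype X] {f f' f'' : ℝ → ℝ} {α : ℝ} (hα : 0 < α)
    (hd1 : ∀ y ∈ Set.Ioi (0 : ℝ), HasDerivAt f (f' y) y)
    (hd2 : ∀ y ∈ Set.Ioi (0 : ℝ), HasDerivAt f' (f'' y) y)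
    (hstrong : ∀ y ∈ Set.Ioi (0 : ℝ), α ≤ f'' y)
    {n : ℕ} {r r' : Fin n → X → ℝ} {w w' : Fin n → ℕ} {p p' π₀ : X → ℝ}
    (hπ₀ : FullSupport π₀)
    (hp : IsModel p) (hpos : FullSupport p)
    (hmax : ∀ π : X → ℝ, IsModel π → ASW f r w π π₀ ≤ ASW f r w p π₀)
    (hp' : IsModel p') (hpos' : FullSupport p')
    (hmax' : ∀ π : X → ℝ, IsModel π → ASW f r' w' π π₀ ≤ ASW f r' w' p' π₀)
    {M : ℝ} (hM : ∀ y, |∑ i, (w i : ℝ) * r i y - ∑ i, (w' i : ℝ) * r' i y| ≤ M) (x : X) :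
    p x - p' x ≤ (2 * π₀ x / α) * M := by
  have hM0 : 0 ≤ M := (abs_nonneg _).trans (hM x)
  have hx0 := hπ₀ x
  rcases le_or_gt (p x) (p' x) with hle | hlt
  · have : 0 ≤ (2 * π₀ x / α) * M := by positivity
    linarith
  obtain ⟨y, -, hy⟩ : ∃ y ∈ Finset.univ, p y ≤ p' y :=
    Finset.exists_le_of_sum_le ⟨x, Finset.mem_univ x⟩ (hp.2.trans hp'.2.symm).le
  have h1 := mul_sub_le_sub_of_hasDerivAt_ge hd2 hstrong (div_pos (hpos' x) hx0)
    (div_le_div_of_nonneg_right hlt.le hx0.le)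
  have hquot : p y / π₀ y ≤ p' y / π₀ y := div_le_div_of_nonneg_right hy (hπ₀ y).le
  have h2 := mul_sub_le_sub_of_hasDerivAt_ge hd2 hstrong (div_pos (hpos y) (hπ₀ y)) hquot
  have h2' : 0 ≤ α * (p' y / π₀ y - p y / π₀ y) := mul_nonneg hα.le (sub_nonneg.2 hquot)
  have e := ASW_marginal_eq hd1 hπ₀ hp hpos hmax x y
  have e' := ASW_marginal_eq hd1 hπ₀ hp' hpos' hmax' x y
  have hMx := (abs_le.1 (hM x)).2
  have hMy := (abs_le.1 (hM y)).1
  have hkey : α * (p x / π₀ x - p' x / π₀ x) ≤ 2 * M := by linarith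
  rw [← sub_div, mul_div_assoc', div_le_iff₀ hx0] at hkey
  rw [div_mul_eq_mul_div, le_div_iff₀ hα]
  linarith

/-- an α-strongly convex, C² regularizer yields a continuous SW-Max
training rule, with the explicit bound `|π x − π' x| ≤ (2·π₀ x/α)·max_y |…|`, and
in particular the ε-δ continuity property. -/
theorem strongly_convex_swmax_continuous
    [Fintype X] [Nonempty X] {n : ℕ}
    (f f' f'' : ℝ → ℝ) (α : ℝ) (hα : 0 < α)
    (hconv : ConvexOn ℝ (Set.Ioi 0) f) (hf1 : f 1 = 0)
    (hd1 : ∀ y ∈ Set.Ioi (0 : ℝ), HasDerivAt f (f' y) y)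
    (hd2 : ∀ y ∈ Set.Ioi (0 : ℝ), HasDerivAt f' (f'' y) y)
    (hc2 : ContinuousOn f'' (Set.Ioi 0))
    (hstrong : ∀ y ∈ Set.Ioi (0 : ℝ), α ≤ f'' y)
    (Rdom : (X → ℝ) → Prop)
    (hdom : Rdom = (IsRewardSum (X := X)) ∨ Rdom = (IsRewardMax (X := X)))
    (ψ : (Fin n → X → ℝ) → (Fin n → ℕ) → (X → ℝ) → (X → ℝ))
    (hψ : SWMaxRule f Rdom ψ)
    (hfull : ∀ (r : Fin n → X → ℝ) (w : Fin n → ℕ) (π₀ : X → ℝ),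
      (∀ j, Rdom (r j)) → IsModel π₀ → FullSupport π₀ →
      FullSupport (ψ r w π₀)) :
    (∀ (r r' : Fin n → X → ℝ) (w w' : Fin n → ℕ) (π₀ : X → ℝ),
      (∀ j, Rdom (r j)) → (∀ j, Rdom (r' j)) →
      (∀ j, 1 ≤ w j) → (∀ j, 1 ≤ w' j) →
      IsModel π₀ → FullSupport π₀ →
      ∀ x, |ψ r w π₀ x - ψ r' w' π₀ x| ≤
        (2 * π₀ x / α) *
          Finset.univ.sup' Finset.univ_nonempty
            (fun y => |∑ i, (w i : ℝ) * r i y - ∑ i, (w' i : ℝ) * r' i y|)) ∧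
    (∀ ε : ℝ, 0 < ε →
      ∀ (r r' : Fin n → X → ℝ) (w w' : Fin n → ℕ) (π₀ : X → ℝ),
        (∀ j, Rdom (r j)) → (∀ j, Rdom (r' j)) →
        (∀ j, 1 ≤ w j) → (∀ j, 1 ≤ w' j) →
        IsModel π₀ → FullSupport π₀ →
        (∀ y, |∑ i, (w i : ℝ) * r i y - ∑ i, (w' i : ℝ) * r' i y| < α * ε / 2) →
        ∀ x, |ψ r w π₀ x - ψ r' w' π₀ x| ≤ ε) := by
  have hbound : ∀ (r r' : Fin n → X → ℝ) (w w' : Fin n → ℕ) (π₀ : X → ℝ),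
      (∀ j, Rdom (r j)) → (∀ j, Rdom (r' j)) → IsModel π₀ → FullSupport π₀ →
      ∀ M : ℝ, (∀ y, |∑ i, (w i : ℝ) * r i y - ∑ i, (w' i : ℝ) * r' i y| ≤ M) →
      ∀ x, |ψ r w π₀ x - ψ r' w' π₀ x| ≤ (2 * π₀ x / α) * M := by
    intro r r' w w' π₀ hr hr' hm hs M hM x
    obtain ⟨hp, hmax⟩ := hψ r w π₀ hr hm hs
    obtain ⟨hp', hmax'⟩ := hψ r' w' π₀ hr' hm hs
    have hpos := hfull r w π₀ hr hm hs
    have hpos' := hfull r' w' π₀ hr' hm hs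
    refine abs_sub_le_iff.2 ⟨?_, ?_⟩
    · exact ASW_maximizer_sub_le hα hd1 hd2 hstrong hs hp hpos hmax hp' hpos' hmax' hM x
    · exact ASW_maximizer_sub_le hα hd1 hd2 hstrong hs hp' hpos' hmax' hp hpos hmax
        (fun y => by rw [abs_sub_comm]; exact hM y) x
  refine ⟨fun r r' w w' π₀ hr hr' _ _ hm hs => hbound r r' w w' π₀ hr hr' hm hs _ fun y => ?_,
    fun ε hε r r' w w' π₀ hr hr' _ _ hm hs hy x => ?_⟩
  · exact Finset.le_sup' (fun y => |∑ i, (w i : ℝ) * r i y - ∑ i, (w' i : ℝ) * r' i y|)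
      (Finset.mem_univ y)
  · have hx1 : π₀ x ≤ 1 :=
      (Finset.single_le_sum (fun z _ => hm.1 z) (Finset.mem_univ x)).trans_eq hm.2
    calc |ψ r w π₀ x - ψ r' w' π₀ x|
        ≤ (2 * π₀ x / α) * (α * ε / 2) :=
          hbound r r' w w' π₀ hr hr' hm hs _ (fun y => (hy y).le) x
      _ = π₀ x * ε := by field_simp
      _ ≤ ε := mul_le_of_le_one_left hε.le hx1
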